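/- Let U ⊆ ℂ be a domain, let q be a positive integer, and let f : U → ℂ be of class C^q (as a function of the underlying real coordinates). Then ∂̄^q f = 0 on U, where ∂̄ = ½(∂/∂x + i·∂/∂y) is the Wirtinger derivative, if and only if there exist holomorphic functions a_0, …, a_{q−1} on U such that f(z) = ∑_{j=0}^{q−1} a_j(z)·(conj z)^j for all z ∈ U. -/

import Mathlib

noncomputable section

/-- The one-variable Wirtinger derivative `∂̄f = ½(∂f/∂x + i·∂f/∂y)`. -/
def wirtingerBar (f : ℂ → ℂ) : ℂ → ℂ :=
  fun z => (1 / 2 : ℂ) * (fderiv ℝ f z 1 + Complex.I * fderiv ℝ f z Complex.I)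

open Filter Topology in
theorem Filter.EventuallyEq.wirtingerBar_eq {f g : ℂ → ℂ} {z : ℂ} (h : f =ᶠ[𝓝 z] g) :
    wirtingerBar f z = wirtingerBar g z := by
  simp only [wirtingerBar, h.fderiv_eq]

theorem wirtingerBar_sub {f g : ℂ → ℂ} {z : ℂ} (hf : DifferentiableAt ℝ f z)
    (hg : DifferentiableAt ℝ g z) :
    wirtingerBar (fun w => f w - g w) z = wirtingerBar f z - wirtingerBar g z := by
  simp only [wirtingerBar, fderiv_fun_sub hf hg, sub_apply]
  ring

theorem wirtingerBar_sum {ι : Type*} (s : Finset ι) {f : ι → ℂ → ℂ} {z : ℂ}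
    (hf : ∀ i ∈ s, DifferentiableAt ℝ (f i) z) :
    wirtingerBar (fun w => ∑ i ∈ s, f i w) z = ∑ i ∈ s, wirtingerBar (f i) z := by
  simp only [wirtingerBar, fderiv_fun_sum hf, sum_apply, Finset.mul_sum,
    ← Finset.sum_add_distrib]

theorem differentiableAt_mul_conj_pow {a : ℂ → ℂ} {z : ℂ} (ha : DifferentiableAt ℂ a z) (n : ℕ) :
    DifferentiableAt ℝ (fun w => a w * (starRingEnd ℂ w) ^ n) z :=
  (ha.restrictScalars ℝ).mul (Complex.conjCLE.differentiableAt.pow n)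

theorem wirtingerBar_mul_conj_pow {a : ℂ → ℂ} {z : ℂ} (ha : DifferentiableAt ℂ a z) (n : ℕ) :
    wirtingerBar (fun w => a w * (starRingEnd ℂ w) ^ n) z =
      n * a z * (starRingEnd ℂ z) ^ (n - 1) := by
  have hconj : HasFDerivAt (fun w : ℂ => starRingEnd ℂ w)
      (Complex.conjCLE : ℂ →L[ℝ] ℂ) z := Complex.conjCLE.hasFDerivAt
  have h := (ha.hasDerivAt.hasFDerivAt.restrictScalars ℝ).mul (hconj.pow n)
  rw [wirtingerBar, show (fun w => a w * (starRingEnd ℂ w) ^ n) =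
    a * (fun w => (starRingEnd ℂ w) ^ n) from rfl, h.fderiv]
  simp
  linear_combination (1 / 2 * (deriv a z * (starRingEnd ℂ z) ^ n -
    n * a z * (starRingEnd ℂ z) ^ (n - 1))) * Complex.I_sq

theorem wirtingerBar_sum_mul_conj_pow {q : ℕ} {a : Fin (q + 1) → ℂ → ℂ} {z : ℂ}
    (ha : ∀ j, DifferentiableAt ℂ (a j) z) :
    wirtingerBar (fun w => ∑ j, a j w * (starRingEnd ℂ w) ^ (j : ℕ)) z =
      ∑ j : Fin q, ((j : ℂ) + 1) * a j.succ z * (starRingEnd ℂ z) ^ (j : ℕ) := by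
  rw [wirtingerBar_sum _ fun j _ => differentiableAt_mul_conj_pow (ha j) j]
  simp_rw [fun j => wirtingerBar_mul_conj_pow (ha j) (j : ℕ)]
  simp [Fin.sum_univ_succ]

theorem differentiableAt_complex_of_wirtingerBar_eq_zero {f : ℂ → ℂ} {z : ℂ}
    (hf : DifferentiableAt ℝ f z) (h : wirtingerBar f z = 0) : DifferentiableAt ℂ f z := by
  refine differentiableAt_complex_iff_differentiableAt_real.2 ⟨hf, ?_⟩
  rw [wirtingerBar] at h
  rw [smul_eq_mul]
  linear_combination (-2 * Complex.I) * h + fderiv ℝ f z Complex.I * Complex.I_sq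

theorem ContDiffOn.wirtingerBar {U : Set ℂ} (hU : IsOpen U) {n : ℕ} {f : ℂ → ℂ}
    (hf : ContDiffOn ℝ (n + 1 : ℕ) f U) : ContDiffOn ℝ n (_root_.wirtingerBar f) U := by
  have h : ContDiffOn ℝ n (fderiv ℝ f) U := hf.fderiv_of_isOpen hU (by norm_cast)
  exact contDiffOn_const.mul ((h.clm_apply contDiffOn_const).add
    (contDiffOn_const.mul (h.clm_apply contDiffOn_const)))

theorem wirtingerBar_iterate_eq_zero {U : Set ℂ} (hU : IsOpen U) {q : ℕ} {f : ℂ → ℂ}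
    {a : Fin q → ℂ → ℂ} (ha : ∀ j, DifferentiableOn ℂ (a j) U)
    (hfa : ∀ z ∈ U, f z = ∑ j, a j z * (starRingEnd ℂ z) ^ (j : ℕ)) :
    ∀ z ∈ U, (wirtingerBar^[q] f) z = 0 := by
  induction q generalizing f with
  | zero => simpa using hfa
  | succ q ih =>
    refine ih (a := fun j z => ((j : ℂ) + 1) * a j.succ z) (fun j => (ha _).const_mul _) ?_
    intro z hz
    rw [(Filter.eventuallyEq_of_mem (hU.mem_nhds hz) hfa).wirtingerBar_eq]
    exact wirtingerBar_sum_mul_conj_pow fun j => (ha j).differentiableAt (hU.mem_nhds hz)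

theorem exists_eq_sum_mul_conj_pow {U : Set ℂ} (hU : IsOpen U) {q : ℕ} {f : ℂ → ℂ}
    (hf : ContDiffOn ℝ q f U) (h : ∀ z ∈ U, (wirtingerBar^[q] f) z = 0) :
    ∃ a : Fin q → ℂ → ℂ, (∀ j, DifferentiableOn ℂ (a j) U) ∧
      ∀ z ∈ U, f z = ∑ j : Fin q, a j z * (starRingEnd ℂ z) ^ (j : ℕ) := by
  induction q generalizing f with
  | zero => exact ⟨fun _ => 0, fun j => j.elim0, by simpa using h⟩
  | succ q ih =>
    obtain ⟨b, hb, hfb⟩ := ih (hf.wirtingerBar hU) h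
    let c : Fin (q + 1) → ℂ → ℂ := Fin.cons 0 fun j z => ((j : ℂ) + 1)⁻¹ * b j z
    have hc : ∀ j, DifferentiableOn ℂ (c j) U :=
      Fin.cases (differentiableOn_const 0) fun j => (hb j).const_mul _
    let p : ℂ → ℂ := fun z => ∑ j, c j z * (starRingEnd ℂ z) ^ (j : ℕ)
    have hg : DifferentiableOn ℂ (fun z => f z - p z) U := by
      intro z hz
      have hcz := fun j => (hc j).differentiableAt (hU.mem_nhds hz)
      have hfz : DifferentiableAt ℝ f z :=
        (hf.contDiffAt (hU.mem_nhds hz)).differentiableAt (by norm_cast)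
      have hpz : DifferentiableAt ℝ p z :=
        .fun_sum fun j _ => differentiableAt_mul_conj_pow (hcz j) j
      refine (differentiableAt_complex_of_wirtingerBar_eq_zero (hfz.sub hpz)
        ?_).differentiableWithinAt
      refine (wirtingerBar_sub hfz hpz).trans ?_
      rw [hfb z hz, wirtingerBar_sum_mul_conj_pow hcz, sub_eq_zero]
      refine Finset.sum_congr rfl fun j _ => ?_
      simp only [c, Fin.cons_succ]
      rw [mul_inv_cancel_left₀ (Nat.cast_add_one_ne_zero _)]
    refine ⟨Fin.cons (fun z => f z - p z) fun j => c j.succ, Fin.cases hg fun j => hc j.succ, ?_⟩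
    intro z hz
    simp [Fin.sum_univ_succ, p, c]

theorem q_analytic_iff_wirtinger
    (U : Set ℂ) (hopen : IsOpen U) (hconn : IsConnected U)
    (q : ℕ) (hq : 0 < q)
    (f : ℂ → ℂ) (hf : ContDiffOn ℝ q f U) :
    (∀ z ∈ U, (wirtingerBar^[q] f) z = 0) ↔
      ∃ a : Fin q → ℂ → ℂ, (∀ j, DifferentiableOn ℂ (a j) U) ∧
        ∀ z ∈ U, f z = ∑ j : Fin q, a j z * (starRingEnd ℂ z) ^ (j : ℕ) :=
  ⟨exists_eq_sum_mul_conj_pow hopen hf,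
    fun ⟨_, ha, hfa⟩ => wirtingerBar_iterate_eq_zero hopen ha hfa⟩
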